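/- Let n ≥ 1, let μ be the Haar probability measure on the unitary group U(n), and let X be any n×n complex matrix. Then ∫_{U(n)} U X U† dμ(U) = (tr(X)/n)·I; i.e., averaging conjugation over the unitary group with respect to Haar measure yields the completely depolarizing channel Ω(X) = (tr(X)/n)·I. -/

import Mathlib

open Matrix MeasureTheory

attribute [local instance] Matrix.normedAddCommGroup Matrix.normedSpace

noncomputable section

open scoped Matrix.Norms.L2Operator in
/-- The complex linear span of the unitary group is the whole matrix algebra. -/
theorem span_unitaryGroup_eq_top (n : ℕ) :
    Submodule.span ℂ (Matrix.unitaryGroup (Fin n) ℂ : Set (Matrix (Fin n) (Fin n) ℂ)) = ⊤ :=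
  CStarAlgebra.span_unitary (A := Matrix (Fin n) (Fin n) ℂ)

/-- A matrix commuting with every unitary is a scalar matrix. -/
theorem mem_range_scalar_of_commute_unitaryGroup {n : ℕ} {M : Matrix (Fin n) (Fin n) ℂ}
    (hM : ∀ V : Matrix.unitaryGroup (Fin n) ℂ, (V : Matrix (Fin n) (Fin n) ℂ) * M = M * V) :
    M ∈ Set.range (Matrix.scalar (Fin n)) := by
  have key : ∀ A : Matrix (Fin n) (Fin n) ℂ, A * M = M * A := by
    intro A
    have hA : A ∈ Submodule.span ℂ
        (Matrix.unitaryGroup (Fin n) ℂ : Set (Matrix (Fin n) (Fin n) ℂ)) := by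
      rw [span_unitaryGroup_eq_top]; trivial
    induction hA using Submodule.span_induction with
    | mem V hV => exact hM ⟨V, hV⟩
    | zero => simp
    | add A B _ _ hA hB => rw [add_mul, mul_add, hA, hB]
    | smul c A _ hA => rw [smul_mul_assoc, mul_smul_comm, hA]
  exact mem_range_scalar_of_commute_single fun i j _ => key _

/-- The entrywise sup norm is compatible with the product topology on matrices. -/
local instance matrixContinuousENorm (n : ℕ) : ContinuousENorm (Matrix (Fin n) (Fin n) ℂ) :=
  inferInstanceAs (ContinuousENorm (Fin n → Fin n → ℂ))

local instance matrixSecondCountableTopology (n : ℕ) :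
    SecondCountableTopology (Matrix (Fin n) (Fin n) ℂ) :=
  inferInstanceAs (SecondCountableTopology (Fin n → Fin n → ℂ))

local instance matrixPseudoMetrizableSpace (n : ℕ) :
    TopologicalSpace.PseudoMetrizableSpace (Matrix (Fin n) (Fin n) ℂ) :=
  inferInstanceAs (TopologicalSpace.PseudoMetrizableSpace (Fin n → Fin n → ℂ))

/-- Conjugation of a fixed matrix by unitaries is integrable for any finite measure. -/
theorem integrable_unitary_conj {n : ℕ}
    [MeasurableSpace (Matrix.unitaryGroup (Fin n) ℂ)]
    [BorelSpace (Matrix.unitaryGroup (Fin n) ℂ)]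
    (μ : Measure (Matrix.unitaryGroup (Fin n) ℂ)) [IsFiniteMeasure μ]
    (X : Matrix (Fin n) (Fin n) ℂ) :
    Integrable (fun U : Matrix.unitaryGroup (Fin n) ℂ =>
      (U : Matrix (Fin n) (Fin n) ℂ) * X * (U : Matrix (Fin n) (Fin n) ℂ)ᴴ) μ := by
  have hc : Continuous (fun U : Matrix.unitaryGroup (Fin n) ℂ =>
      (U : Matrix (Fin n) (Fin n) ℂ) * X * (U : Matrix (Fin n) (Fin n) ℂ)ᴴ) := by
    fun_prop
  have hcont : Continuous (fun A : Matrix (Fin n) (Fin n) ℂ => A * X * Aᴴ) := by fun_prop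
  obtain ⟨C, hC⟩ := (isCompact_closedBall (0 : Matrix (Fin n) (Fin n) ℂ) 1)
    |>.exists_bound_of_continuousOn hcont.continuousOn
  have : SecondCountableTopology (Matrix.unitaryGroup (Fin n) ℂ) :=
    TopologicalSpace.Subtype.secondCountableTopology _
  refine Integrable.of_bound hc.aestronglyMeasurable C (.of_forall fun U => hC _ ?_)
  rw [mem_closedBall_zero_iff]
  exact entrywise_sup_norm_bound_of_unitary U.2

/-- for `n ≥ 1`, `μ` the Haar probability measure on the unitary group
`U(n)`, and any `n × n` complex matrix `X`, the (Bochner) average of the conjugates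
`U X U†` over `U(n)` is `(tr X / n) · I`; i.e. averaging conjugation over the unitary
group yields the completely depolarizing channel. -/
theorem stmt16 (n : ℕ) (hn : 1 ≤ n)
    [MeasurableSpace (Matrix.unitaryGroup (Fin n) ℂ)]
    [BorelSpace (Matrix.unitaryGroup (Fin n) ℂ)]
    (μ : Measure (Matrix.unitaryGroup (Fin n) ℂ))
    [μ.IsHaarMeasure] [IsProbabilityMeasure μ]
    (X : Matrix (Fin n) (Fin n) ℂ) :
    ∫ U : Matrix.unitaryGroup (Fin n) ℂ,
        ((U : Matrix (Fin n) (Fin n) ℂ) * X * (U : Matrix (Fin n) (Fin n) ℂ)ᴴ) ∂μ =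
      (X.trace / (n : ℂ)) • (1 : Matrix (Fin n) (Fin n) ℂ) := by
  set f : Matrix.unitaryGroup (Fin n) ℂ → Matrix (Fin n) (Fin n) ℂ :=
    fun U => (U : Matrix (Fin n) (Fin n) ℂ) * X * (U : Matrix (Fin n) (Fin n) ℂ)ᴴ with hf
  have hint : Integrable f μ := integrable_unitary_conj μ X
  have htrace : (∫ U, f U ∂μ).trace = X.trace := by
    have h : ∫ U, (f U).trace ∂μ = (∫ U, f U ∂μ).trace := (LinearMap.toContinuousLinearMap
      (Matrix.traceLinearMap (Fin n) ℂ ℂ)).integral_comp_comm hint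
    have hU : ∀ U, (f U).trace = X.trace := fun U => by
      rw [hf, Matrix.trace_mul_comm, ← mul_assoc, ← star_eq_conjTranspose,
        UnitaryGroup.star_mul_self, one_mul]
    simpa [hU] using h.symm
  have hcomm (V : Matrix.unitaryGroup (Fin n) ℂ) :
      (V : Matrix (Fin n) (Fin n) ℂ) * (∫ U, f U ∂μ) = (∫ U, f U ∂μ) * V := by
    have h : (∫ U, (V : Matrix (Fin n) (Fin n) ℂ) * f U * star V.1 ∂μ)
        = (V : Matrix (Fin n) (Fin n) ℂ) * (∫ U, f U ∂μ) * star V.1 :=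
      (LinearMap.toContinuousLinearMap
        (LinearMap.mulLeftRight ℂ (V.1, star V.1))).integral_comp_comm hint
    have hinv : (∫ U, (V : Matrix (Fin n) (Fin n) ℂ) * f U * star V.1 ∂μ) = ∫ U, f U ∂μ := by
      rw [← integral_mul_left_eq_self f V]
      simp only [hf, UnitaryGroup.mul_val, conjTranspose_mul, star_eq_conjTranspose, mul_assoc]
    rw [hinv] at h
    conv_rhs => rw [h, mul_assoc, UnitaryGroup.star_mul_self, mul_one]
  obtain ⟨c, hc⟩ := mem_range_scalar_of_commute_unitaryGroup hcomm
  have hn' : (n : ℂ) ≠ 0 := by exact_mod_cast (by omega : n ≠ 0)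
  rw [← hc] at htrace ⊢
  have hcn : X.trace = n * c := by simpa [Matrix.trace] using htrace.symm
  rw [hcn, mul_div_cancel_left₀ c hn', scalar_apply, Matrix.smul_one_eq_diagonal]

end
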